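/- Let Σ be a symmetric positive definite real matrix indexed by V×V. Let a, c, z ∈ V be distinct, B ⊆ V \ {a, c, z}, and x ∈ V \ (B ∪ {a, c, z}). Assume Σ_{az} = 0, Σ_{ca} = 0, Σ_{cz} = 0, and σ_{uw|{x}} = 0 for every u ∈ {a, c, z} and every w ∈ B (i.e., {a,c,z} ⟂⟂ B | x). Assume moreover Σ_{ax} ≠ 0 and Σ_{cx} ≠ 0. Then ρ²_{ac|B∪{z}} ≥ ρ²_{ac|{x}} if and only if (Σ_{xx} + Σ_{xz}²/Σ_{zz}) · Σ_{xB}(Σ_{BB})^{-1}Σ_{Bx} ≥ Σ_{xx}², equivalently if and only if (Σ_{xx} − σ_{xx|B})/Σ_{xx} ≥ σ_{zz|B}/Σ_{zz}. -/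

import Mathlib

open Matrix

variable {V : Type*}

/-- Partial covariance `σ_{uv|Z} = Σ_{uv} − Σ_{uZ} (Σ_{ZZ})⁻¹ Σ_{Zv}`. -/
noncomputable def pcov [Fintype V] [DecidableEq V] (S : Matrix V V ℝ) (u v : V) (Z : Finset V) : ℝ :=
  S u v - ∑ i : {x // x ∈ Z}, ∑ j : {x // x ∈ Z},
    S u (i : V) * (Matrix.of (fun i j : {x // x ∈ Z} => S (i : V) (j : V)))⁻¹ i j * S (j : V) v

/-- Squared partial correlation `ρ²_{uv|Z}`. -/
noncomputable def rho2 [Fintype V] [DecidableEq V] (S : Matrix V V ℝ) (u v : V) (Z : Finset V) : ℝ :=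
  pcov S u v Z ^ 2 / (pcov S u u Z * pcov S v v Z)

/-- The quadratic form `Σ_{xB} (Σ_{BB})⁻¹ Σ_{Bx}`. -/
noncomputable def quadf [Fintype V] [DecidableEq V] (S : Matrix V V ℝ) (x : V) (B : Finset V) : ℝ :=
  ∑ i : {v // v ∈ B}, ∑ j : {v // v ∈ B},
    S x (i : V) * (Matrix.of (fun i j : {v // v ∈ B} => S (i : V) (j : V)))⁻¹ i j * S (j : V) x

/-- `β` is supported on `Z` and solves the normal equations `Σ_{ZZ} β_Z = Σ_{Zv}`. -/
def IsRegression [Fintype V] (S : Matrix V V ℝ) (v : V) (Z : Finset V) (β : V → ℝ) : Prop :=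
  (∀ i, i ∉ Z → β i = 0) ∧ ∀ i ∈ Z, (S *ᵥ β) i = S i v

theorem mulVec_apply_of_support [Fintype V] (S : Matrix V V ℝ) {Z : Finset V} {β : V → ℝ}
    (hβ : ∀ i, i ∉ Z → β i = 0) (u : V) :
    (S *ᵥ β) u = ∑ i : {x // x ∈ Z}, S u (i : V) * β i := by
  rw [Finset.sum_coe_sort Z (fun i => S u i * β i)]
  refine (Finset.sum_subset (Finset.subset_univ Z) fun i _ hi => ?_).symm
  simp [hβ i hi]

theorem Matrix.PosDef.isUnit_det_principal [Fintype V] [DecidableEq V] {S : Matrix V V ℝ}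
    (hpd : S.PosDef) (Z : Finset V) :
    IsUnit (Matrix.of (fun i j : {x // x ∈ Z} => S (i : V) (j : V))).det :=
  (hpd.submatrix (e := ((↑) : {x // x ∈ Z} → V)) Subtype.val_injective).det_pos.ne'.isUnit

theorem IsRegression.pcov_eq [Fintype V] [DecidableEq V] {S : Matrix V V ℝ} (hpd : S.PosDef)
    {v : V} {Z : Finset V} {β : V → ℝ} (hβ : IsRegression S v Z β) (u : V) :
    pcov S u v Z = S u v - (S *ᵥ β) u := by
  have hdet := hpd.isUnit_det_principal Z
  rw [pcov, mulVec_apply_of_support S hβ.1]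
  set M := Matrix.of (fun i j : {x // x ∈ Z} => S (i : V) (j : V))
  have h1 : M *ᵥ (fun i : {x // x ∈ Z} => β i) = fun i : {x // x ∈ Z} => S (i : V) v := by
    funext i
    rw [← hβ.2 i i.2, mulVec_apply_of_support S hβ.1]
    rfl
  have h2 : M⁻¹ *ᵥ (fun i : {x // x ∈ Z} => S (i : V) v) = fun i : {x // x ∈ Z} => β i := by
    rw [← h1, mulVec_mulVec, nonsing_inv_mul _ hdet, one_mulVec]
  congr 1
  refine Finset.sum_congr rfl fun i _ => ?_
  rw [← congrFun h2 i, mulVec, dotProduct, Finset.mul_sum]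
  simp only [mul_assoc]

theorem exists_isRegression [Fintype V] [DecidableEq V] {S : Matrix V V ℝ} (hpd : S.PosDef)
    (v : V) (Z : Finset V) : ∃ β, IsRegression S v Z β := by
  have hdet := hpd.isUnit_det_principal Z
  set M := Matrix.of (fun i j : {x // x ∈ Z} => S (i : V) (j : V)) with hM
  let y : {x // x ∈ Z} → ℝ := M⁻¹ *ᵥ (fun i => S (i : V) v)
  have hy : M *ᵥ y = fun i : {x // x ∈ Z} => S (i : V) v := by
    rw [mulVec_mulVec, mul_nonsing_inv _ hdet, one_mulVec]
  have h0 : ∀ i, i ∉ Z → (fun i => if hi : i ∈ Z then y ⟨i, hi⟩ else 0) i = 0 :=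
    fun i hi => by simp [hi]
  refine ⟨fun i => if hi : i ∈ Z then y ⟨i, hi⟩ else 0, h0, fun i hi => ?_⟩
  rw [mulVec_apply_of_support S h0, ← congrFun hy ⟨i, hi⟩]
  simp [mulVec, dotProduct, hM]

theorem pcov_self_pos [Fintype V] [DecidableEq V] {S : Matrix V V ℝ} (hpd : S.PosDef)
    {u : V} {Z : Finset V} (hu : u ∉ Z) : 0 < pcov S u u Z := by
  obtain ⟨β, hβ⟩ := exists_isRegression hpd u Z
  have hw : (Pi.single u 1 - β : V → ℝ) ≠ 0 := fun h0 => by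
    simpa [hβ.1 u hu] using congrFun h0 u
  have hSw : S *ᵥ (Pi.single u 1 - β) = fun i => S i u - (S *ᵥ β) i := by
    funext i
    simp [mulVec_sub]
  have hdot : β ⬝ᵥ (S *ᵥ (Pi.single u 1 - β)) = 0 := by
    rw [hSw]
    refine Finset.sum_eq_zero fun i _ => ?_
    by_cases hi : i ∈ Z
    · simp [hβ.2 i hi]
    · simp [hβ.1 i hi]
  have hpos := hpd.dotProduct_mulVec_pos hw
  rw [star_trivial, sub_dotProduct, hdot, sub_zero, single_dotProduct, hSw] at hpos
  rw [hβ.pcov_eq hpd]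
  simpa using hpos

theorem pcov_singleton [Fintype V] [DecidableEq V] {S : Matrix V V ℝ} (hpd : S.PosDef)
    (u v x : V) : pcov S u v {x} = S u v - S u x * S x v / S x x := by
  have hx : S x x ≠ 0 := hpd.diag_pos.ne'
  have hβ : IsRegression S v {x} (Pi.single x (S x v / S x x)) := by
    refine ⟨fun i hi => ?_, fun i hi => ?_⟩
    · simp [Finset.mem_singleton.not.mp hi]
    · obtain rfl := Finset.mem_singleton.mp hi
      simp
      field_simp
  rw [hβ.pcov_eq hpd]
  simp
  ring

theorem pcov_insert [Fintype V] [DecidableEq V] {S : Matrix V V ℝ} (hpd : S.PosDef)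
    {z : V} {B : Finset V} (hz : z ∉ B) (u v : V) :
    pcov S u v (insert z B) =
      pcov S u v B - pcov S u z B * pcov S z v B / pcov S z z B := by
  have hzz := (pcov_self_pos hpd hz).ne'
  obtain ⟨β, hβ⟩ := exists_isRegression hpd v B
  obtain ⟨η, hη⟩ := exists_isRegression hpd z B
  set k := pcov S z v B / pcov S z z B with hk
  have key : ∀ i, (S *ᵥ (β - k • η + k • Pi.single z 1)) i =
      S i v - pcov S i v B + k * pcov S i z B := by
    intro i
    rw [hβ.pcov_eq hpd, hη.pcov_eq hpd]
    simp [mulVec_add, mulVec_sub, mulVec_smul]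
    ring
  have hnew : IsRegression S v (insert z B) (β - k • η + k • Pi.single z 1) := by
    refine ⟨fun i hi => ?_, fun i hi => ?_⟩
    · rw [Finset.mem_insert, not_or] at hi
      simp [hβ.1 i hi.2, hη.1 i hi.2, hi.1]
    · rw [key]
      rcases Finset.mem_insert.mp hi with rfl | hi
      · rw [hk]
        field_simp
        ring
      · rw [hβ.pcov_eq hpd, hη.pcov_eq hpd, hβ.2 i hi, hη.2 i hi]
        ring
  rw [hnew.pcov_eq hpd, key, hk]
  ring

theorem quadf_eq_sub_pcov [Fintype V] [DecidableEq V] (S : Matrix V V ℝ) (x : V) (B : Finset V) :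
    quadf S x B = S x x - pcov S x x B := by
  rw [quadf, pcov, sub_sub_cancel]

theorem quadf_nonneg [Fintype V] [DecidableEq V] {S : Matrix V V ℝ} (hsym : S.IsSymm)
    (hpd : S.PosDef) (x : V) (B : Finset V) : 0 ≤ quadf S x B := by
  obtain ⟨β, hβ⟩ := exists_isRegression hpd x B
  rw [quadf_eq_sub_pcov, hβ.pcov_eq hpd, sub_sub_cancel]
  refine (hpd.posSemidef.dotProduct_mulVec_nonneg β).trans_eq ?_
  refine Finset.sum_congr rfl fun i _ => ?_
  by_cases hi : i ∈ B
  · rw [hβ.2 i hi, hsym.apply x i, star_trivial, mul_comm]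
  · simp [hβ.1 i hi]

/-- If `u, v ⟂⟂ B | x`, then the covariance of `u` and `v` explained by `B` factors through `x`. -/
theorem pcov_eq_of_pcov_singleton_eq_zero [Fintype V] [DecidableEq V] {S : Matrix V V ℝ}
    (hsym : S.IsSymm) (hpd : S.PosDef) {u v x : V} {B : Finset V}
    (hu : ∀ w ∈ B, pcov S u w {x} = 0) (hv : ∀ w ∈ B, pcov S v w {x} = 0) :
    pcov S u v B = S u v - S u x * S v x * (quadf S x B / S x x ^ 2) := by
  have factor : ∀ y, (∀ w ∈ B, pcov S y w {x} = 0) → ∀ w ∈ B, S y w = S y x / S x x * S x w := by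
    intro y hy w hw
    have := hy w hw
    rw [pcov_singleton hpd] at this
    linear_combination this
  obtain ⟨β, hβ⟩ := exists_isRegression hpd x B
  have hβv : IsRegression S v B ((S v x / S x x) • β) := by
    refine ⟨fun i hi => by simp [hβ.1 i hi], fun i hi => ?_⟩
    rw [mulVec_smul, Pi.smul_apply, hβ.2 i hi, smul_eq_mul, ← hsym.apply i x, ← hsym.apply i v,
      factor v hv i hi]
  have hSu : (S *ᵥ β) u = S u x / S x x * (S *ᵥ β) x := by
    rw [mulVec_apply_of_support S hβ.1, mulVec_apply_of_support S hβ.1, Finset.mul_sum]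
    exact Finset.sum_congr rfl fun i _ => by rw [factor u hu i i.2, mul_assoc]
  rw [hβv.pcov_eq hpd, mulVec_smul, Pi.smul_apply, hSu, quadf_eq_sub_pcov, hβ.pcov_eq hpd,
    smul_eq_mul]
  ring

/-- `m ↦ (αγm)² / ((A - α²m)(C - γ²m))` is strictly increasing as long as `m ≥ 0` and both factors
of the denominator are positive. -/
theorem sq_div_mul_le_iff {A C α γ m n : ℝ} (hα : α ≠ 0) (hγ : γ ≠ 0) (hm : 0 ≤ m) (hn : 0 ≤ n)
    (hAm : 0 < A - α ^ 2 * m) (hCm : 0 < C - γ ^ 2 * m)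
    (hAn : 0 < A - α ^ 2 * n) (hCn : 0 < C - γ ^ 2 * n) :
    (α * γ * m) ^ 2 / ((A - α ^ 2 * m) * (C - γ ^ 2 * m)) ≤
      (α * γ * n) ^ 2 / ((A - α ^ 2 * n) * (C - γ ^ 2 * n)) ↔ m ≤ n := by
  have hA : 0 < A := by nlinarith [mul_nonneg (sq_nonneg α) hm]
  have hC : 0 < C := by nlinarith [mul_nonneg (sq_nonneg γ) hm]
  have hα2 : 0 < α ^ 2 := by positivity
  have hγ2 : 0 < γ ^ 2 := by positivity
  have hdiff : (α * γ * n) ^ 2 * ((A - α ^ 2 * m) * (C - γ ^ 2 * m)) -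
      (α * γ * m) ^ 2 * ((A - α ^ 2 * n) * (C - γ ^ 2 * n)) =
      (n - m) * (α ^ 2 * γ ^ 2 *
        (C * n * (A - α ^ 2 * m) + m * A * (C - γ ^ 2 * n))) := by
    ring
  rw [div_le_div_iff₀ (mul_pos hAm hCm) (mul_pos hAn hCn), ← sub_nonneg, hdiff]
  have h1 : 0 ≤ C * n * (A - α ^ 2 * m) := by positivity
  have h2 : 0 ≤ m * A * (C - γ ^ 2 * n) := by positivity
  constructor
  · intro h
    by_contra! hlt
    have h3 : 0 < m * A * (C - γ ^ 2 * n) := mul_pos (mul_pos (hn.trans_lt hlt) hA) hCn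
    have h4 : 0 < α ^ 2 * γ ^ 2 *
        (C * n * (A - α ^ 2 * m) + m * A * (C - γ ^ 2 * n)) := by positivity
    nlinarith
  · intro h
    have := sub_nonneg.mpr h
    positivity

/-- Theorem 5: under `a ⟂⟂ z`, `c ⟂⟂ {a,z}`, `{a,c,z} ⟂⟂ B | x`
(and `Σ_{ax} ≠ 0`, `Σ_{cx} ≠ 0`), `ρ²_{ac|B∪{z}} ≥ ρ²_{ac|x}` iff
`(Σ_{xx} + Σ_{xz}²/Σ_{zz}) Σ_{xB}Σ_{BB}⁻¹Σ_{Bx} ≥ Σ_{xx}²`, equivalently iff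
`(Σ_{xx} − σ_{xx|B})/Σ_{xx} ≥ σ_{zz|B}/Σ_{zz}`. -/
theorem stmt_10 [Fintype V] [DecidableEq V] [Nonempty V]
    (S : Matrix V V ℝ) (hsym : S.IsSymm) (hpd : S.PosDef)
    (a c z : V) (hac : a ≠ c) (haz : a ≠ z) (hcz : c ≠ z)
    (B : Finset V) (haB : a ∉ B) (hcB : c ∉ B) (hzB : z ∉ B)
    (x : V) (hxB : x ∉ B) (hxa : x ≠ a) (hxc : x ≠ c) (hxz : x ≠ z)
    (hSaz : S a z = 0) (hSca : S c a = 0) (hScz : S c z = 0)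
    (h : ∀ u ∈ ({a, c, z} : Finset V), ∀ w ∈ B, pcov S u w {x} = 0)
    (hax : S a x ≠ 0) (hcx : S c x ≠ 0) :
    (rho2 S a c {x} ≤ rho2 S a c (insert z B) ↔
      S x x ^ 2 ≤ (S x x + S x z ^ 2 / S z z) * quadf S x B) ∧
    (S x x ^ 2 ≤ (S x x + S x z ^ 2 / S z z) * quadf S x B ↔
      pcov S z z B / S z z ≤ (S x x - pcov S x x B) / S x x) := by
  have hca : S a c = 0 := by rw [← hSca, hsym.apply]
  have hza : S z c = 0 := by rw [← hScz, hsym.apply]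
  have hp : 0 < S x x := hpd.diag_pos
  have hs : 0 < S z z := hpd.diag_pos
  have hq := quadf_nonneg hsym hpd x B
  have ha := h a (by simp)
  have hc := h c (by simp)
  have hz := h z (by simp)
  have hxx := quadf_eq_sub_pcov S x B
  have hzzB := pcov_eq_of_pcov_singleton_eq_zero hsym hpd hz hz
  have hzz_pos := pcov_self_pos hpd hzB
  have haz_ins : a ∉ insert z B := by simp [haz, haB]
  have hcz_ins : c ∉ insert z B := by simp [hcz, hcB]
  have hAx := pcov_self_pos hpd (Finset.notMem_singleton.mpr hxa.symm)
  have hCx := pcov_self_pos hpd (Finset.notMem_singleton.mpr hxc.symm)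
  have hAB := pcov_self_pos hpd haz_ins
  have hCB := pcov_self_pos hpd hcz_ins
  set q := quadf S x B with hq_def
  set t := q / S x x ^ 2 with ht_def
  have ht : 0 ≤ t := by positivity
  have hD : 0 < S z z - S z x * S z x * t := hzzB ▸ hzz_pos
  set n := t * S z z / (S z z - S z x * S z x * t) with hn_def
  have hn : 0 ≤ n := by positivity
  have hm : 0 ≤ 1 / S x x := by positivity
  have single : ∀ u v, pcov S u v {x} = S u v - S u x * S v x * (1 / S x x) := by
    intro u v
    rw [pcov_singleton hpd, hsym.apply v x]
    ring
  have ins : ∀ u v, (∀ w ∈ B, pcov S u w {x} = 0) → (∀ w ∈ B, pcov S v w {x} = 0) →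
      S u z = 0 → S z v = 0 → pcov S u v (insert z B) = S u v - S u x * S v x * n := by
    intro u v hu hv huz hzv
    rw [pcov_insert hpd hzB, hzzB, pcov_eq_of_pcov_singleton_eq_zero hsym hpd hu hv,
      pcov_eq_of_pcov_singleton_eq_zero hsym hpd hu hz,
      pcov_eq_of_pcov_singleton_eq_zero hsym hpd hz hv, huz, hzv, hn_def,
      ← hq_def, ← ht_def]
    linear_combination (S u x * S v x * t) * div_self hD.ne'
  have hSza : S z a = 0 := by rw [← hSaz, hsym.apply]
  rw [single a a] at hAx
  rw [single c c] at hCx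
  rw [ins a a ha ha hSaz hSza] at hAB
  rw [ins c c hc hc hScz hza] at hCB
  have hmain : S x x ^ 2 ≤ (S x x + S x z ^ 2 / S z z) * q ↔
      S x x ^ 2 * S z z ≤ (S x x * S z z + S z x ^ 2) * q := by
    rw [hsym.apply z x, ← mul_le_mul_iff_left₀ hs]
    field_simp
  refine ⟨?_, ?_⟩
  · rw [hmain]
    have hmn : 1 / S x x ≤ n ↔
        S x x ^ 2 * S z z ≤ (S x x * S z z + S z x ^ 2) * q := by
      rw [hn_def, div_le_div_iff₀ hp hD, ← mul_le_mul_iff_left₀ (pow_pos hp 2), ht_def]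
      field_simp
      constructor <;> intro h' <;> nlinarith
    rw [← hmn, ← sq_div_mul_le_iff hax hcx hm hn (A := S a a) (C := S c c)
      (by rwa [pow_two]) (by rwa [pow_two]) (by rwa [pow_two]) (by rwa [pow_two])]
    rw [rho2, rho2, single, single, single, ins a c ha hc hSaz hza, ins a a ha ha hSaz hSza,
      ins c c hc hc hScz hza, hca, zero_sub, zero_sub, neg_sq, neg_sq]
    simp only [pow_two]
  · rw [hmain, ← hxx, hzzB, div_le_div_iff₀ hs hp, ← mul_le_mul_iff_left₀ hp, ht_def]
    field_simp
    constructor <;> intro h' <;> nlinarith
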